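/- arXiv:2512.10220 — 2 statements merged into one kernel-verified Lean document; each statement's English description precedes it below -/
import Mathlib

section
/- Let d ≥ 1 and n > d+2 be integers. Let Y_1, …, Y_n be i.i.d. standard Gaussian random vectors in ℝ^d, let Ȳ := (1/n) ∑_{i=1}^n Y_i, let Ŝ_n := (1/n) ∑_{i=1}^n (Y_i − Ȳ)(Y_i − Ȳ)ᵀ, and let g_d(x) := (∑_{j=1}^d ψ((x−j)/2)) − d·log(x/2) + (x+1)·d/(x−d−2). Then the expected forward KL risk of the Gaussian MLE with unknown mean and covariance equals E[ (1/2)(log det Ŝ_n + tr(Ŝ_n⁻¹) + Ȳᵀ Ŝ_n⁻¹ Ȳ − d) ] = (1/2)(g_d(n) − d). -/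
open MeasureTheory ProbabilityTheory Matrix

/-- The digamma function `ψ(x) = (log Γ)'(x)`. -/
noncomputable def digamma (x : ℝ) : ℝ := deriv (fun t => Real.log (Real.Gamma t)) x

/-- `g_d(x) = ∑_{j=1}^d ψ((x-j)/2) - d log(x/2) + (x+1) d/(x-d-2)`. -/
noncomputable def gFun (d : ℕ) (x : ℝ) : ℝ :=
  (∑ j ∈ Finset.Icc 1 d, digamma ((x - j) / 2)) - d * Real.log (x / 2)
    + (x + 1) * d / (x - d - 2)

/-- The law of `n` i.i.d. standard Gaussian vectors in `ℝ^d`. -/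
noncomputable def stdGaussianSample (n d : ℕ) : Measure (Fin n → Fin d → ℝ) :=
  Measure.pi fun _ => Measure.pi fun _ => gaussianReal 0 1

/-- Sample mean `Ȳ = (1/n) ∑ Y_i`. -/
noncomputable def sampleMean (n d : ℕ) (Y : Fin n → Fin d → ℝ) : Fin d → ℝ :=
  ((n : ℝ)⁻¹) • ∑ i : Fin n, Y i

/-- Centered empirical covariance `Ŝ_n = (1/n) ∑ (Y_i - Ȳ)(Y_i - Ȳ)ᵀ`. -/
noncomputable def empCov (n d : ℕ) (Y : Fin n → Fin d → ℝ) :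
    Matrix (Fin d) (Fin d) ℝ :=
  ((n : ℝ)⁻¹) • ∑ i : Fin n,
    vecMulVec (Y i - sampleMean n d Y) (Y i - sampleMean n d Y)

/-- Standard Gaussian on `Fin k → ℝ`. -/
noncomputable def gam (k : ℕ) : Measure (Fin k → ℝ) := Measure.pi fun _ => gaussianReal 0 1

instance (k : ℕ) : IsProbabilityMeasure (gam k) := by unfold gam; infer_instance

lemma gam_density (k : ℕ) : gam k = (volume : Measure (Fin k → ℝ)).withDensity
    (fun x => ENNReal.ofReal (((√(2 * Real.pi))⁻¹) ^ k * Real.exp (-(∑ i, x i ^ 2) / 2))) := by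
  have hpdf : ∀ x : Fin k → ℝ, ((√(2 * Real.pi))⁻¹) ^ k * Real.exp (-(∑ i, x i ^ 2) / 2)
      = ∏ i, gaussianPDFReal 0 1 (x i) := by
    intro x
    simp only [gaussianPDFReal, Finset.prod_mul_distrib, ← Real.exp_sum]
    simp [neg_div, Finset.sum_div]
  simp_rw [hpdf]
  unfold gam
  refine Measure.pi_eq (fun s hs => ?_)
  rw [withDensity_apply _ (MeasurableSet.univ_pi hs), volume_pi, Measure.restrict_pi_pi,
    ← ofReal_integral_eq_lintegral_ofReal, integral_fintype_prod_eq_prod (f := fun _ x => gaussianPDFReal 0 1 x),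
    ENNReal.ofReal_prod_of_nonneg]
  · refine Finset.prod_congr rfl (fun i _ => ?_)
    rw [gaussianReal_apply_eq_integral _ one_ne_zero]
  · intro i _
    exact integral_nonneg (fun x => gaussianPDFReal_nonneg _ _ _)
  · exact Integrable.fintype_prod (f := fun _ x => gaussianPDFReal 0 1 x)
      (fun i => (integrable_gaussianPDFReal 0 1).restrict)
  · exact Filter.Eventually.of_forall fun x => Finset.prod_nonneg fun i _ => gaussianPDFReal_nonneg _ _ _

lemma chi_polar (k : ℕ) (hk : 1 ≤ k) : ∃ C : ℝ, ∀ f : ℝ → ℝ,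
    (Integrable (fun x : Fin k → ℝ => f (∑ i, x i ^ 2)) (gam k) ↔
      IntegrableOn (fun t : ℝ => Real.exp (-t) * t ^ ((k : ℝ) / 2 - 1) * f (2 * t)) (Set.Ioi 0)) ∧
    ∫ x, f (∑ i, x i ^ 2) ∂(gam k) =
      C * ∫ t in Set.Ioi (0 : ℝ), Real.exp (-t) * t ^ ((k : ℝ) / 2 - 1) * f (2 * t) := by
  set c : ℝ := ((√(2 * Real.pi))⁻¹) ^ k with hc
  have hcpos : 0 < c := by positivity
  have : Nonempty (Fin k) := ⟨⟨0, hk⟩⟩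
  have : Nontrivial (EuclideanSpace ℝ (Fin k)) := by infer_instance
  set F : (ℝ → ℝ) → ℝ → ℝ := fun f y => c * Real.exp (-(y ^ 2) / 2) * f (y ^ 2) with hF
  have hmeas : Measurable (fun x : Fin k → ℝ => ENNReal.ofReal (c * Real.exp (-(∑ i, x i ^ 2) / 2))) := by
    fun_prop
  have hnorm : ∀ x : Fin k → ℝ, ‖(WithLp.toLp 2 x : EuclideanSpace ℝ (Fin k))‖ ^ 2 = ∑ i, x i ^ 2 := by
    intro x; rw [EuclideanSpace.real_norm_sq_eq]
  have hdim : Module.finrank ℝ (EuclideanSpace ℝ (Fin k)) = k := by simp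
  have key : ∀ f : ℝ → ℝ, (fun x : Fin k → ℝ => (ENNReal.ofReal (c * Real.exp (-(∑ i, x i ^ 2) / 2))).toReal •
      f (∑ i, x i ^ 2)) = (fun y : EuclideanSpace ℝ (Fin k) => F f ‖y‖) ∘ (WithLp.toLp 2) := by
    intro f
    funext x
    simp only [hF, Function.comp, hnorm, smul_eq_mul]
    rw [ENNReal.toReal_ofReal (by positivity)]
  -- change of variables
  have cv : ∀ f : ℝ → ℝ, ∀ y ∈ Set.Ioi (0:ℝ), y ^ (k - 1) • F f y =
      (2 * y ^ ((2:ℝ) - 1)) • (fun s => c / 2 * (Real.exp (-(s/2)) * s ^ ((k:ℝ)/2 - 1) * f s)) (y ^ (2:ℝ)) := by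
    intro f y hy
    have hy' : 0 < y := hy
    simp only [hF, smul_eq_mul]
    have e1 : y ^ (2:ℝ) = y ^ 2 := by norm_cast
    have e2 : (y ^ (2:ℝ)) ^ ((k:ℝ)/2 - 1) = y ^ ((k:ℝ) - 2) := by
      rw [← Real.rpow_mul hy'.le]; congr 1; ring
    have e3 : y ^ (k - 1) = y ^ ((2:ℝ) - 1) * y ^ ((k:ℝ) - 2) := by
      rw [← Real.rpow_add hy', ← Real.rpow_natCast, Nat.cast_sub hk]; congr 1; push_cast; ring
    rw [e2, e3, e1, neg_div]; ring
  have cv2 : ∀ f : ℝ → ℝ, (fun t : ℝ => (fun s => c / 2 * (Real.exp (-(s/2)) * s ^ ((k:ℝ)/2 - 1) * f s)) (2 * t)) 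
      =ᵐ[volume.restrict (Set.Ioi 0)] fun t =>  (c / 2 * 2 ^ ((k:ℝ)/2 - 1)) * (Real.exp (-t) * t ^ ((k : ℝ) / 2 - 1) * f (2 * t)) := by
    intro f
    filter_upwards [ae_restrict_mem measurableSet_Ioi] with t ht
    have ht' : (0:ℝ) < t := ht
    rw [Real.mul_rpow (by norm_num) ht'.le]
    have : 2 * t / 2 = t := by ring
    simp only [this]; ring
  have hc2 : (c / 2 * 2 ^ ((k:ℝ)/2 - 1)) ≠ 0 := by positivity
  refine ⟨k * (volume : Measure (EuclideanSpace ℝ (Fin k))).real (Metric.ball 0 1) * (2 * (c / 2 * 2 ^ ((k:ℝ)/2 - 1))), fun f => ⟨?_, ?_⟩⟩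
  · rw [gam_density, integrable_withDensity_iff_integrable_smul' hmeas (by simp), key,
      (PiLp.volume_preserving_toLp (Fin k)).integrable_comp_emb (MeasurableEquiv.toLp 2 _).measurableEmbedding,
      integrable_fun_norm_addHaar, hdim, integrableOn_congr_fun (cv f) measurableSet_Ioi]
    have h2 := integrableOn_Ioi_comp_rpow_iff (fun s => c / 2 * (Real.exp (-(s/2)) * s ^ ((k:ℝ)/2 - 1) * f s)) (p := 2) two_ne_zero
    rw [abs_two] at h2
    rw [h2]
    have h3 := integrableOn_Ioi_comp_mul_left_iff (fun s => c / 2 * (Real.exp (-(s/2)) * s ^ ((k:ℝ)/2 - 1) * f s)) 0 (a := 2) two_pos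
    rw [mul_zero] at h3
    rw [← h3, IntegrableOn, integrable_congr (cv2 f), IntegrableOn]
    exact integrable_const_mul_iff (isUnit_iff_ne_zero.mpr hc2) _
  · rw [gam_density, integral_withDensity_eq_integral_toReal_smul hmeas (by simp), key]
    have h1 := (PiLp.volume_preserving_toLp (Fin k)).integral_comp (MeasurableEquiv.toLp 2 _).measurableEmbedding
       (fun y : EuclideanSpace ℝ (Fin k) => F f ‖y‖)
    rw [Function.comp_def, h1, integral_fun_norm_addHaar, hdim, setIntegral_congr_fun measurableSet_Ioi (cv f)]
    rw [integral_comp_rpow_Ioi_of_pos (g := (fun s => c / 2 * (Real.exp (-(s/2)) * s ^ ((k:ℝ)/2 - 1) * f s))) two_pos]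
    have h3 := integral_comp_mul_left_Ioi (fun s => c / 2 * (Real.exp (-(s/2)) * s ^ ((k:ℝ)/2 - 1) * f s)) 0 (b := 2) two_pos
    rw [mul_zero] at h3
    have h4 : ∀ (I J : ℝ), I = (2:ℝ)⁻¹ • J → J = 2 * I := by intro I J h; rw [h, smul_eq_mul]; ring
    rw [h4 _ _ h3, integral_congr_ae (cv2 f), integral_const_mul]
    simp only [nsmul_eq_mul, smul_eq_mul]; ring

lemma log_gamma (s : ℝ) (hs : 0 < s) :
    IntegrableOn (fun t : ℝ => Real.exp (-t) * t ^ (s - 1) * Real.log t) (Set.Ioi 0) ∧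
    ∫ t in Set.Ioi (0 : ℝ), Real.exp (-t) * t ^ (s - 1) * Real.log t = digamma s * Real.Gamma s := by
  have hm := mellin_hasDerivAt_of_isBigO_rpow (E := ℂ) (f := fun x : ℝ => ((Real.exp (-x) : ℝ) : ℂ)) (s := (s:ℂ)) (a := s + 1) (b := 0)
    (by
      refine (Continuous.continuousOn ?_).locallyIntegrableOn measurableSet_Ioi
      fun_prop)
    (by
      rw [← Asymptotics.isBigO_norm_left]
      simp_rw [Complex.norm_real, Asymptotics.isBigO_norm_left]
      simpa only [neg_one_mul] using (isLittleO_exp_neg_mul_rpow_atTop zero_lt_one _).isBigO)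
    (by simp)
    (by
      simp_rw [neg_zero, Real.rpow_zero]
      refine Asymptotics.isBigO_const_of_tendsto (y := (1 : ℂ)) ?_ one_ne_zero
      have : Continuous fun x : ℝ => ((Real.exp (-x) : ℝ) : ℂ) := by fun_prop
      have h := (this.tendsto 0).mono_left (nhdsWithin_le_nhds (s := Set.Ioi 0))
      simpa using h)
    (by simpa using hs)
  have heq : ∀ t ∈ Set.Ioi (0:ℝ), (t : ℂ) ^ ((s : ℂ) - 1) • (Real.log t • ((Real.exp (-t) : ℝ) : ℂ)) =
      ((Real.exp (-t) * t ^ (s - 1) * Real.log t : ℝ) : ℂ) := by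
    intro t ht
    have : (t : ℂ) ^ ((s : ℂ) - 1) = ((t ^ (s - 1) : ℝ) : ℂ) := by
      rw [Complex.ofReal_cpow (le_of_lt ht)]; push_cast; rfl
    rw [this]
    simp only [smul_eq_mul, Complex.real_smul]
    push_cast; ring
  obtain ⟨h1, h2⟩ := hm
  unfold MellinConvergent at h1
  rw [integrableOn_congr_fun heq measurableSet_Ioi] at h1
  unfold mellin at h2
  rw [setIntegral_congr_fun measurableSet_Ioi heq, integral_complex_ofReal] at h2
  refine ⟨?_, ?_⟩
  · have := h1.re
    exact this
  · have h3 := h2.real_of_complex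
    have h4 : HasDerivAt Real.Gamma (∫ t in Set.Ioi (0 : ℝ), Real.exp (-t) * t ^ (s - 1) * Real.log t) s := by
      rw [Complex.ofReal_re] at h3
      refine h3.congr_of_eventuallyEq ?_
      filter_upwards [lt_mem_nhds hs] with x hx
      have : Complex.Gamma x = Complex.GammaIntegral x := Complex.Gamma_eq_integral (by simpa using hx)
      rw [Complex.GammaIntegral_eq_mellin] at this
      unfold mellin at this
      rw [← this, Complex.Gamma_ofReal, Complex.ofReal_re]
    have hG := (Real.Gamma_pos_of_pos hs).ne'
    rw [digamma, (h4.log hG).deriv]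
    field_simp

/-- The two chi-square expectations. -/
lemma chi_log (k : ℕ) (hk : 1 ≤ k) :
    Integrable (fun x : Fin k → ℝ => Real.log (∑ i, x i ^ 2)) (gam k) ∧
    ∫ x, Real.log (∑ i, x i ^ 2) ∂(gam k) = digamma ((k : ℝ) / 2) + Real.log 2 := by
  obtain ⟨C, hC⟩ := chi_polar k hk
  have hs : (0:ℝ) < (k:ℝ)/2 := by positivity
  have hG := (Real.Gamma_pos_of_pos hs)
  have h1 := (hC (fun _ => 1)).2
  simp only [mul_one] at h1
  rw [← Real.Gamma_eq_integral hs] at h1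
  simp only [integral_const, probReal_univ, smul_eq_mul, mul_one] at h1
  obtain ⟨li, lv⟩ := log_gamma _ hs
  have heq : ∀ t ∈ Set.Ioi (0:ℝ), Real.exp (-t) * t ^ ((k:ℝ)/2 - 1) * Real.log (2 * t) =
     Real.log 2 * (Real.exp (-t) * t ^ ((k:ℝ)/2 - 1)) + Real.exp (-t) * t ^ ((k:ℝ)/2 - 1) * Real.log t := by
    intro t ht
    rw [Real.log_mul two_ne_zero (ne_of_gt ht)]; ring
  have i1 := (Real.GammaIntegral_convergent hs).const_mul (Real.log 2)
  refine ⟨?_, ?_⟩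
  · rw [(hC _).1, integrableOn_congr_fun heq measurableSet_Ioi]
    exact i1.add li
  · rw [(hC _).2, setIntegral_congr_fun measurableSet_Ioi heq, integral_add i1 li, integral_const_mul,
      ← Real.Gamma_eq_integral hs, lv]
    linear_combination (-(digamma (k/2)) - Real.log 2) * h1

lemma chi_inv (k : ℕ) (hk : 3 ≤ k) :
    Integrable (fun x : Fin k → ℝ => (∑ i, x i ^ 2)⁻¹) (gam k) ∧
    ∫ x, (∑ i, x i ^ 2)⁻¹ ∂(gam k) = ((k : ℝ) - 2)⁻¹ := by
  obtain ⟨C, hC⟩ := chi_polar k (by omega)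
  have hk' : (3:ℝ) ≤ k := by exact_mod_cast hk
  have hs : (0:ℝ) < (k:ℝ)/2 := by positivity
  have hs' : (0:ℝ) < (k:ℝ)/2 - 1 := by linarith
  have hG := (Real.Gamma_pos_of_pos hs)
  have h1 := (hC (fun _ => 1)).2
  simp only [mul_one] at h1
  rw [← Real.Gamma_eq_integral hs] at h1
  simp only [integral_const, probReal_univ, smul_eq_mul, mul_one] at h1
  have heq : ∀ t ∈ Set.Ioi (0:ℝ), Real.exp (-t) * t ^ ((k:ℝ)/2 - 1) * (2 * t)⁻¹ =
     2⁻¹ * (Real.exp (-t) * t ^ ((k:ℝ)/2 - 1 - 1)) := by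
    intro t ht
    have ht' : 0 < t := ht
    rw [Real.rpow_sub_one ht'.ne' ((k:ℝ)/2 - 1)]; field_simp
  have i1 := (Real.GammaIntegral_convergent hs').const_mul (2⁻¹)
  have hrec := Real.Gamma_add_one hs'.ne'
  rw [sub_add_cancel] at hrec
  refine ⟨?_, ?_⟩
  · rw [(hC (fun x => x⁻¹)).1, integrableOn_congr_fun heq measurableSet_Ioi]
    exact i1
  · rw [(hC (fun x => x⁻¹)).2, setIntegral_congr_fun measurableSet_Ioi heq, integral_const_mul,
      ← Real.Gamma_eq_integral hs']
    rw [hrec] at h1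
    have : (k:ℝ) - 2 ≠ 0 := by linarith
    generalize Real.Gamma ((k:ℝ) / 2 - 1) = g at h1 ⊢
    field_simp
    linear_combination -2 * h1

lemma gam_map {k m : ℕ} (A : Matrix (Fin k) (Fin m) ℝ) (hA : A * Aᵀ = 1) :
    MeasurePreserving (fun x => A *ᵥ x) (gam m) (gam k) := by
  have hmA : Measurable (fun x : Fin m → ℝ => A *ᵥ x) := by
    have : Continuous (fun x : Fin m → ℝ => A *ᵥ x) := by fun_prop
    exact this.measurable
  refine ⟨hmA, ?_⟩
  refine (MeasurableEquiv.toLp 2 (Fin k → ℝ)).map_measurableEquiv_injective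
      <| Measure.ext_of_charFun (E := EuclideanSpace ℝ (Fin k)) <| funext fun t => ?_
  have e1 : ∀ t : EuclideanSpace ℝ (Fin k), charFun ((gam k).map (WithLp.toLp 2)) t = Complex.exp (- ‖t‖ ^ 2 / 2) := by
    intro t; unfold gam; rw [map_pi_eq_stdGaussian, charFun_stdGaussian]
  have e2 : ∀ t : EuclideanSpace ℝ (Fin m), charFun ((gam m).map (WithLp.toLp 2)) t = Complex.exp (- ‖t‖ ^ 2 / 2) := by
    intro t; unfold gam; rw [map_pi_eq_stdGaussian, charFun_stdGaussian]
  rw [MeasurableEquiv.coe_toLp, e1]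
  have hn : ‖t‖ ^ 2 = ‖(WithLp.toLp 2 (Aᵀ *ᵥ t.ofLp) : EuclideanSpace ℝ (Fin m))‖ ^ 2 := by
    rw [EuclideanSpace.real_norm_sq_eq, EuclideanSpace.real_norm_sq_eq]
    have h1 : ∑ i, t i ^ 2 = t.ofLp ⬝ᵥ ((A * Aᵀ) *ᵥ t.ofLp) := by
      rw [hA, one_mulVec]; simp [dotProduct, sq]
    rw [h1, ← mulVec_mulVec, dotProduct_mulVec, ← mulVec_transpose]
    simp [dotProduct, sq]
  have hn' := congrArg (fun r : ℝ => Complex.exp (-(r : ℂ) / 2)) hn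
  simp only [Complex.ofReal_pow] at hn'
  rw [hn', ← e2, charFun_apply, charFun_apply, integral_map, integral_map, integral_map]
  · refine integral_congr_ae (Filter.Eventually.of_forall fun x => ?_)
    have : inner ℝ (WithLp.toLp 2 (A *ᵥ x) : EuclideanSpace ℝ (Fin k)) t
       = inner ℝ (WithLp.toLp 2 x : EuclideanSpace ℝ (Fin m)) (WithLp.toLp 2 (Aᵀ *ᵥ t.ofLp)) := by
      simp only [EuclideanSpace.inner_eq_star_dotProduct, star_trivial]
      rw [dotProduct_mulVec, vecMul_eq_sum, mulVec_transpose, ← dotProduct_mulVec, dotProduct_comm]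
      simp only [dotProduct, mulVec, Finset.sum_apply, Pi.smul_apply, smul_eq_mul]
      simp only [Finset.mul_sum]
      rw [Finset.sum_comm]
      refine Finset.sum_congr rfl fun i _ => Finset.sum_congr rfl fun j _ => by ring
    simp only [this]
  all_goals first | exact hmA.aemeasurable | exact Measurable.aemeasurable (by fun_prop) | exact Continuous.aestronglyMeasurable (by fun_prop)

/-- Gram matrix. -/
def grm {d m : ℕ} (Z : Fin d → Fin m → ℝ) : Matrix (Fin d) (Fin d) ℝ := of fun a b => Z a ⬝ᵥ Z b

lemma grm_eq {d m : ℕ} (Z : Fin d → Fin m → ℝ) : grm Z = (of Z) * (of Z)ᵀ := by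
  ext a b; simp [grm, mul_apply, dotProduct]

lemma exists_B {r m : ℕ} (A : Fin r → Fin m → ℝ) (h : (grm A).det ≠ 0) :
    ∃ B : Matrix (Fin (m - r)) (Fin m) ℝ, B * Bᵀ = 1 ∧
      ∀ x : Fin m → ℝ, x ⬝ᵥ x - (of A *ᵥ x) ⬝ᵥ ((grm A)⁻¹ *ᵥ (of A *ᵥ x)) = (B *ᵥ x) ⬝ᵥ (B *ᵥ x) := by
  have hu : IsUnit (grm A).det := isUnit_iff_ne_zero.mpr h
  set v : Fin r → EuclideanSpace ℝ (Fin m) := fun j => WithLp.toLp 2 (A j) with hv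
  have hin : ∀ x y : EuclideanSpace ℝ (Fin m), inner ℝ x y = x.ofLp ⬝ᵥ y.ofLp := by
    intro x y; simp [EuclideanSpace.inner_eq_star_dotProduct, dotProduct_comm]
  have hli : LinearIndependent ℝ v := by
    rw [Fintype.linearIndependent_iff]
    intro g hg
    have h0 : grm A *ᵥ g = 0 := by
      funext a
      have h1 : inner ℝ (v a) (∑ j, g j • v j) = 0 := by rw [hg, inner_zero_right]
      rw [inner_sum] at h1
      simp only [hin, hv] at h1
      simp only [mulVec, dotProduct, grm, of_apply, Pi.zero_apply] at h1 ⊢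
      rw [← h1]
      refine Finset.sum_congr rfl fun j _ => ?_
      rw [Finset.sum_mul]
      refine Finset.sum_congr rfl fun k _ => ?_
      simp only [PiLp.smul_apply, smul_eq_mul]; ring
    have := eq_zero_of_mulVec_eq_zero h h0
    intro i; rw [this]; rfl
  set V := Submodule.span ℝ (Set.range v) with hV
  have hfV : Module.finrank ℝ V = r := by
    rw [hV, finrank_span_eq_card hli, Fintype.card_fin]
  have hsum := Submodule.finrank_add_finrank_orthogonal V
  rw [hfV, finrank_euclideanSpace_fin] at hsum
  have hrm : r ≤ m := by omega
  have hfO : Module.finrank ℝ Vᗮ = m - r := by omega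
  let b := (stdOrthonormalBasis ℝ Vᗮ).reindex (finCongr hfO)
  let B : Matrix (Fin (m - r)) (Fin m) ℝ := of fun i => ((b i : Vᗮ) : EuclideanSpace ℝ (Fin m)).ofLp
  have hBB : B * Bᵀ = 1 := by
    ext i j
    have h1 : inner ℝ (b i) (b j) = if i = j then (1:ℝ) else 0 := orthonormal_iff_ite.mp b.orthonormal i j
    rw [Submodule.coe_inner, hin] at h1
    rw [one_apply, ← h1]
    simp [B, mul_apply, dotProduct]
  have hAB : of A * Bᵀ = 0 := by
    ext i j
    have h1 : inner ℝ (v i) ((b j : Vᗮ) : EuclideanSpace ℝ (Fin m)) = 0 :=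
      (Submodule.mem_orthogonal V _).mp (b j).2 _ (Submodule.subset_span ⟨i, rfl⟩)
    rw [hin] at h1
    rw [Matrix.zero_apply, ← h1]
    simp [B, mul_apply, dotProduct, hv]
  have hBA : B * (of A)ᵀ = 0 := by
    have := congrArg transpose hAB
    simpa [transpose_mul] using this
  have hLR : fromRows ((grm A)⁻¹ * of A) B * fromCols (of A)ᵀ Bᵀ = 1 := by
    rw [fromRows_mul_fromCols, hBB, hBA, Matrix.mul_assoc, Matrix.mul_assoc, hAB, ← grm_eq, nonsing_inv_mul _ hu,
      Matrix.mul_zero, fromBlocks_one]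
  have hRL := (mul_eq_one_comm_of_equiv (finSumFinEquiv.trans (finCongr (by omega)))).mp hLR
  rw [fromCols_mul_fromRows] at hRL
  refine ⟨B, hBB, fun x => ?_⟩
  have h1 : x ⬝ᵥ x = x ⬝ᵥ (((of A)ᵀ * ((grm A)⁻¹ * of A) + Bᵀ * B) *ᵥ x) := by rw [hRL, one_mulVec]
  rw [h1, add_mulVec, dotProduct_add, ← mulVec_mulVec, ← mulVec_mulVec, ← mulVec_mulVec,
    dotProduct_mulVec x, vecMul_transpose, dotProduct_mulVec x, vecMul_transpose]
  ring

lemma det_insert {r m : ℕ} (i : Fin (r + 1)) (x : Fin m → ℝ) (A : Fin r → Fin m → ℝ) (h : (grm A).det ≠ 0) :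
    (grm (i.insertNth x A : Fin (r + 1) → Fin m → ℝ)).det =
      (grm A).det * (x ⬝ᵥ x - (of A *ᵥ x) ⬝ᵥ ((grm A)⁻¹ *ᵥ (of A *ᵥ x))) := by
  have hu : IsUnit (grm A).det := isUnit_iff_ne_zero.mpr h
  let e : Fin r ⊕ Unit ≃ Fin (r + 1) := (Equiv.optionEquivSumPUnit (Fin r)).symm.trans (finSuccEquiv' i).symm
  have hel : ∀ j, e (Sum.inl j) = i.succAbove j := by intro j; simp [e]
  have her : ∀ u, e (Sum.inr u) = i := by intro j; simp [e]
  rw [← det_submatrix_equiv_self e]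
  have hb : (grm (i.insertNth x A : Fin (r + 1) → Fin m → ℝ)).submatrix e e =
      fromBlocks (grm A) (of fun j _ => (of A *ᵥ x) j) (of fun _ j => (of A *ᵥ x) j) (of fun _ _ => x ⬝ᵥ x) := by
    ext a b
    rcases a with a | a <;> rcases b with b | b <;>
      simp [hel, her, grm, mulVec, dotProduct_comm]
  let _ := (grm A).invertibleOfIsUnitDet hu
  rw [hb, det_fromBlocks₁₁, det_unique (n := Unit), invOf_eq_nonsing_inv]
  congr 1
  simp only [Matrix.sub_apply, of_apply]
  congr 1
  rw [Matrix.mul_assoc]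
  rfl

lemma inv_diag {r m : ℕ} (i : Fin (r + 1)) (x : Fin m → ℝ) (A : Fin r → Fin m → ℝ) :
    (grm (i.insertNth x A : Fin (r + 1) → Fin m → ℝ))⁻¹ i i =
      ((grm (i.insertNth x A : Fin (r + 1) → Fin m → ℝ)).det / (grm A).det)⁻¹ := by
  rw [inv_def, Matrix.smul_apply, adjugate_fin_succ_eq_det_submatrix, Ring.inverse_eq_inv', smul_eq_mul, inv_div]
  have hb : (grm (i.insertNth x A : Fin (r + 1) → Fin m → ℝ)).submatrix i.succAbove i.succAbove = grm A := by
    ext a b; simp [grm]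
  rw [hb, ← two_mul, pow_mul]
  simp
  ring

/-- The key conditional law. -/
lemma key_law {r m : ℕ} (i : Fin (r + 1)) (A : Fin r → Fin m → ℝ) (h : (grm A).det ≠ 0) :
    ∃ B : Matrix (Fin (m - r)) (Fin m) ℝ, B * Bᵀ = 1 ∧ ∀ x : Fin m → ℝ,
      (grm (i.insertNth x A : Fin (r + 1) → Fin m → ℝ)).det / (grm A).det = ∑ j, (B *ᵥ x) j ^ 2 := by
  obtain ⟨B, h1, h2⟩ := exists_B A h
  refine ⟨B, h1, fun x => ?_⟩
  rw [det_insert i x A h, h2, mul_div_cancel_left₀ _ h]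
  simp [dotProduct, sq]

/-- `d` i.i.d. standard Gaussian vectors in `ℝ^m`. -/
noncomputable def gamd (d m : ℕ) : Measure (Fin d → Fin m → ℝ) := Measure.pi fun _ => gam m

instance (d m : ℕ) : IsProbabilityMeasure (gamd d m) := by unfold gamd; infer_instance

lemma continuous_grm {d m : ℕ} : Continuous (fun Z : Fin d → Fin m → ℝ => grm Z) := by
  unfold grm
  refine continuous_matrix fun a b => ?_
  simp only [of_apply, dotProduct]
  fun_prop

lemma continuous_det_grm {d m : ℕ} : Continuous (fun Z : Fin d → Fin m → ℝ => (grm Z).det) :=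
  continuous_grm.matrix_det

lemma measurable_inv_grm {d m : ℕ} (a b : Fin d) : Measurable (fun Z : Fin d → Fin m → ℝ => (grm Z)⁻¹ a b) := by
  simp only [inv_def, Matrix.smul_apply, Ring.inverse_eq_inv', smul_eq_mul]
  refine (continuous_det_grm.measurable.inv).mul ?_
  have : Continuous (fun Z : Fin d → Fin m → ℝ => (grm Z).adjugate a b) :=
    (continuous_grm.matrix_adjugate).matrix_elem a b
  exact this.measurable

lemma mp_insert {r m : ℕ} (i : Fin (r + 1)) :
    MeasurePreserving (fun p : (Fin m → ℝ) × (Fin r → Fin m → ℝ) => (i.insertNth p.1 p.2 : Fin (r + 1) → Fin m → ℝ))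
      ((gam m).prod (gamd r m)) (gamd (r + 1) m) :=
  (measurePreserving_piFinSuccAbove (fun _ : Fin (r + 1) => gam m) i).symm

lemma me_insert {r m : ℕ} (i : Fin (r + 1)) :
    MeasurableEmbedding (fun p : (Fin m → ℝ) × (Fin r → Fin m → ℝ) => (i.insertNth p.1 p.2 : Fin (r + 1) → Fin m → ℝ)) :=
  (MeasurableEquiv.piFinSuccAbove (fun _ : Fin (r + 1) => Fin m → ℝ) i).symm.measurableEmbedding

lemma chi_pos (k : ℕ) (hk : 1 ≤ k) : ∀ᵐ x ∂(gam k), ∑ i, x i ^ 2 ≠ 0 := by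
  have : Nonempty (Fin k) := ⟨⟨0, hk⟩⟩
  have : ∀ᵐ x ∂(gam k), x ≠ 0 := by
    have h1 : NullSingletonClass (gaussianReal 0 1) := nullSingletonClass_gaussianReal one_ne_zero
    have : NullSingletonClass (gam k) := by unfold gam; infer_instance
    exact Measure.ae_ne _ _
  filter_upwards [this] with x hx h0
  apply hx
  rw [Finset.sum_eq_zero_iff_of_nonneg (fun i _ => sq_nonneg _)] at h0
  funext i
  simpa using h0 i (Finset.mem_univ i)

lemma nonsing (m : ℕ) : ∀ d, d ≤ m → ∀ᵐ Z ∂(gamd d m), (grm Z).det ≠ 0 := by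
  intro d
  induction d with
  | zero => intro _; exact Filter.Eventually.of_forall fun Z => by simp
  | succ r ih =>
    intro hr
    have hA := ih (by omega)
    rw [← (mp_insert (m := m) (0 : Fin (r + 1))).map_eq,
      (me_insert (m := m) (0 : Fin (r + 1))).ae_map_iff]
    have hms : MeasurableSet {p : (Fin m → ℝ) × (Fin r → Fin m → ℝ) |
        (grm ((0 : Fin (r + 1)).insertNth p.1 p.2 : Fin (r + 1) → Fin m → ℝ)).det ≠ 0} := by
      have : Measurable (fun p : (Fin m → ℝ) × (Fin r → Fin m → ℝ) =>
        (grm ((0 : Fin (r + 1)).insertNth p.1 p.2 : Fin (r + 1) → Fin m → ℝ)).det) :=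
        continuous_det_grm.measurable.comp (me_insert (m := m) (0 : Fin (r + 1))).measurable
      exact (this (measurableSet_singleton 0)).compl
    refine (Measure.ae_prod_iff_ae_ae hms).mpr ((Measure.ae_ae_comm (p := fun x A =>
      (grm ((0 : Fin (r + 1)).insertNth x A : Fin (r + 1) → Fin m → ℝ)).det ≠ 0) hms).mpr ?_)
    filter_upwards [hA] with A hA
    obtain ⟨B, hB, hBx⟩ := key_law 0 A hA
    have := (gam_map B hB).quasiMeasurePreserving.ae (chi_pos (m - r) (by omega))
    filter_upwards [this] with x hx h0
    apply hx
    rw [← hBx x, h0, zero_div]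

lemma cond_int {r m : ℕ} (hr : r < m) (i : Fin (r + 1)) (f : ℝ → ℝ) (hf : Measurable f)
    (hfi : Integrable (fun x : Fin (m - r) → ℝ => f (∑ j, x j ^ 2)) (gam (m - r))) :
    Integrable (fun p : (Fin m → ℝ) × (Fin r → Fin m → ℝ) =>
      f ((grm (i.insertNth p.1 p.2 : Fin (r + 1) → Fin m → ℝ)).det / (grm p.2).det)) ((gam m).prod (gamd r m)) ∧
    ∫ p : (Fin m → ℝ) × (Fin r → Fin m → ℝ),
      f ((grm (i.insertNth p.1 p.2 : Fin (r + 1) → Fin m → ℝ)).det / (grm p.2).det) ∂((gam m).prod (gamd r m))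
      = ∫ x, f (∑ j, x j ^ 2) ∂(gam (m - r)) := by
  have hmeas : Measurable (fun p : (Fin m → ℝ) × (Fin r → Fin m → ℝ) =>
      f ((grm (i.insertNth p.1 p.2 : Fin (r + 1) → Fin m → ℝ)).det / (grm p.2).det)) := by
    refine hf.comp (Measurable.div ?_ ?_)
    · exact continuous_det_grm.measurable.comp (me_insert (m := m) i).measurable
    · exact continuous_det_grm.measurable.comp measurable_snd
  have hns := nonsing m r hr.le
  have hsec : ∀ A : Fin r → Fin m → ℝ, (grm A).det ≠ 0 → ∀ g : ℝ → ℝ, Measurable g →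
      Integrable (fun x : Fin (m - r) → ℝ => g (∑ j, x j ^ 2)) (gam (m - r)) →
      Integrable (fun x => g ((grm (i.insertNth x A : Fin (r + 1) → Fin m → ℝ)).det / (grm A).det)) (gam m) ∧
      ∫ x, g ((grm (i.insertNth x A : Fin (r + 1) → Fin m → ℝ)).det / (grm A).det) ∂(gam m)
       = ∫ x, g (∑ j, x j ^ 2) ∂(gam (m - r)) := by
    intro A hA g hg hgi
    obtain ⟨B, hB, hBx⟩ := key_law i A hA
    simp_rw [hBx]
    have mp := gam_map B hB
    refine ⟨(mp.integrable_comp hgi.aestronglyMeasurable).mpr hgi, ?_⟩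
    rw [← mp.map_eq, integral_map mp.measurable.aemeasurable (by rw [mp.map_eq]; exact hgi.aestronglyMeasurable)]
  have hIntg : Integrable (fun p : (Fin m → ℝ) × (Fin r → Fin m → ℝ) =>
      f ((grm (i.insertNth p.1 p.2 : Fin (r + 1) → Fin m → ℝ)).det / (grm p.2).det)) ((gam m).prod (gamd r m)) := by
    rw [integrable_prod_iff' hmeas.aestronglyMeasurable]
    refine ⟨?_, ?_⟩
    · filter_upwards [hns] with A hA
      exact (hsec A hA f hf hfi).1
    · refine (integrable_const (∫ x, ‖f (∑ j, x j ^ 2)‖ ∂(gam (m - r)))).congr ?_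
      filter_upwards [hns] with A hA
      exact (hsec A hA (fun t => ‖f t‖) hf.norm hfi.norm).2.symm
  refine ⟨hIntg, ?_⟩
  rw [integral_prod_symm _ hIntg, integral_congr_ae (g := fun _ => ∫ x, f (∑ j, x j ^ 2) ∂(gam (m - r)))]
  · simp
  · filter_upwards [hns] with A hA
    exact (hsec A hA f hf hfi).2

lemma E_log (m : ℕ) : ∀ d, d ≤ m → Integrable (fun Z => Real.log (grm Z).det) (gamd d m) ∧
    ∫ Z, Real.log (grm Z).det ∂(gamd d m) =
      ∑ j ∈ Finset.range d, (digamma (((m : ℝ) - j) / 2) + Real.log 2) := by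
  intro d
  induction d with
  | zero => intro _; simp
  | succ r ih =>
    intro hr
    obtain ⟨ih1, ih2⟩ := ih (by omega)
    obtain ⟨c1, c2⟩ := chi_log (m - r) (by omega)
    obtain ⟨k1, k2⟩ := cond_int (m := m) (by omega) (0 : Fin (r + 1)) Real.log Real.measurable_log c1
    have hn1 := nonsing m (r + 1) hr
    rw [← (mp_insert (m := m) (0 : Fin (r + 1))).map_eq,
      (me_insert (m := m) (0 : Fin (r + 1))).ae_map_iff] at hn1
    have hn2 : ∀ᵐ p ∂((gam m).prod (gamd r m)), (grm p.2).det ≠ 0 :=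
      Measure.quasiMeasurePreserving_snd.ae (nonsing m r (by omega))
    have heq : (fun p : (Fin m → ℝ) × (Fin r → Fin m → ℝ) =>
        Real.log (grm ((0 : Fin (r + 1)).insertNth p.1 p.2 : Fin (r + 1) → Fin m → ℝ)).det) =ᵐ[(gam m).prod (gamd r m)]
        fun p => Real.log (grm p.2).det + 
         Real.log ((grm ((0 : Fin (r + 1)).insertNth p.1 p.2 : Fin (r + 1) → Fin m → ℝ)).det / (grm p.2).det) := by
      filter_upwards [hn1, hn2] with p h1 h2
      rw [Real.log_div h1 h2]; ring
    have j1 : Integrable (fun p : (Fin m → ℝ) × (Fin r → Fin m → ℝ) => Real.log (grm p.2).det) ((gam m).prod (gamd r m)) :=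
      ih1.comp_snd (gam m)
    have j2 : ∫ p : (Fin m → ℝ) × (Fin r → Fin m → ℝ), Real.log (grm p.2).det ∂((gam m).prod (gamd r m))
        = ∫ Z, Real.log (grm Z).det ∂(gamd r m) := by
      have := integral_fun_snd (μ := gam m) (ν := gamd r m) (fun Z => Real.log (grm Z).det)
      simpa using this
    refine ⟨?_, ?_⟩
    · rw [← (mp_insert (m := m) (0 : Fin (r + 1))).integrable_comp_emb (me_insert _)]
      exact (j1.add k1).congr heq.symm
    · rw [← (mp_insert (m := m) (0 : Fin (r + 1))).integral_comp (me_insert _), integral_congr_ae heq,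
        integral_add j1 k1, k2, j2, ih2, c2, Finset.sum_range_succ, Nat.cast_sub (by omega)]

lemma E_inv {r m : ℕ} (hr : r + 3 ≤ m) (i : Fin (r + 1)) :
    Integrable (fun Z => (grm Z)⁻¹ i i) (gamd (r + 1) m) ∧
    ∫ Z, (grm Z)⁻¹ i i ∂(gamd (r + 1) m) = ((m : ℝ) - r - 2)⁻¹ := by
  obtain ⟨c1, c2⟩ := chi_inv (m - r) (by omega)
  obtain ⟨k1, k2⟩ := cond_int (m := m) (by omega) i (fun t => t⁻¹) measurable_inv c1
  refine ⟨?_, ?_⟩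
  · rw [← (mp_insert (m := m) i).integrable_comp_emb (me_insert _)]
    simp only [Function.comp_def, inv_diag]
    exact k1
  · rw [← (mp_insert (m := m) i).integral_comp (me_insert _)]
    simp only [inv_diag]
    rw [k2, c2, Nat.cast_sub (by omega)]

lemma E_trace {d m : ℕ} (hd : 1 ≤ d) (hr : d + 2 ≤ m) :
    Integrable (fun Z => ((grm Z)⁻¹).trace) (gamd d m) ∧
    ∫ Z, ((grm Z)⁻¹).trace ∂(gamd d m) = d / ((m : ℝ) - d - 1) := by
  obtain ⟨r, rfl⟩ : ∃ r, d = r + 1 := ⟨d - 1, by omega⟩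
  simp only [trace, diag_apply]
  refine ⟨integrable_finsetSum _ fun i _ => (E_inv (by omega) i).1, ?_⟩
  rw [integral_finsetSum _ fun i _ => (E_inv (by omega) i).1]
  simp only [(E_inv (show r + 3 ≤ m by omega) _).2]
  simp
  rw [div_eq_mul_inv]; ring

lemma gauss_mul {d : ℕ} (a b : Fin d) : Integrable (fun z : Fin d → ℝ => z a * z b) (gam d) ∧
    ∫ z, z a * z b ∂(gam d) = if a = b then 1 else 0 := by
  have hmp : ∀ a, MeasurePreserving (fun z : Fin d → ℝ => z a) (gam d) (gaussianReal 0 1) :=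
    fun a => measurePreserving_eval (fun _ : Fin d => gaussianReal 0 1) a
  have hL : ∀ a, MemLp (fun z : Fin d → ℝ => z a) 2 (gam d) := fun a =>
    (IsGaussian.memLp_two_id (μ := gaussianReal 0 1)).comp_measurePreserving (hmp a)
  refine ⟨(hL a).integrable_mul (hL b), ?_⟩
  have h1 : ∀ a, ∫ z, z a ∂(gam d) = 0 := by
    intro a
    have := integral_map (μ := gam d) (hmp a).measurable.aemeasurable (f := fun x : ℝ => x) (by fun_prop)
    rw [← this, (hmp a).map_eq]; simp
  split_ifs with h
  · subst h
    have := integral_map (μ := gam d) (hmp a).measurable.aemeasurable (f := fun x : ℝ => x * x) (by fun_prop)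
    rw [← this, (hmp a).map_eq]
    have hv := variance_eq_sub (IsGaussian.memLp_two_id (μ := gaussianReal 0 1))
    rw [variance_id_gaussianReal] at hv
    simp [sq] at hv
    simpa using hv.symm
  · have hi : iIndepFun (fun (a : Fin d) (z : Fin d → ℝ) => z a) (gam d) :=
      iIndepFun_pi (μ := fun _ : Fin d => gaussianReal 0 1) (X := fun _ x => x) (fun _ => by fun_prop)
    have := (hi.indepFun h).integral_fun_mul_eq_mul_integral (hL a).aestronglyMeasurable (hL b).aestronglyMeasurable
    rw [this, h1]; simp

lemma E_quad_fix {d : ℕ} (M : Matrix (Fin d) (Fin d) ℝ) : Integrable (fun z : Fin d → ℝ => z ⬝ᵥ M *ᵥ z) (gam d) ∧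
    ∫ z, z ⬝ᵥ M *ᵥ z ∂(gam d) = M.trace := by
  have heq : ∀ z : Fin d → ℝ, z ⬝ᵥ M *ᵥ z = ∑ a, ∑ b, M a b * (z a * z b) := by
    intro z; simp only [dotProduct, mulVec, Finset.mul_sum]
    exact Finset.sum_congr rfl fun i _ => Finset.sum_congr rfl fun j _ => by ring
  simp only [heq]
  have hi : ∀ a b, Integrable (fun z : Fin d → ℝ => M a b * (z a * z b)) (gam d) :=
    fun a b => (gauss_mul a b).1.const_mul _
  refine ⟨integrable_finsetSum _ fun a _ => integrable_finsetSum _ fun b _ => hi a b, ?_⟩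
  rw [integral_finsetSum _ fun a _ => integrable_finsetSum _ fun b _ => hi a b]
  simp only [integral_finsetSum _ fun b _ => hi _ b, integral_const_mul, (gauss_mul _ _).2]
  simp [trace]

lemma grm_posSemidef {d m : ℕ} (Z : Fin d → Fin m → ℝ) : (grm Z).PosSemidef := by
  rw [grm_eq]
  have := posSemidef_self_mul_conjTranspose (of Z)
  simpa [conjTranspose_eq_transpose_of_trivial] using this

lemma E_quad {d m : ℕ} (hd : 1 ≤ d) (hr : d + 2 ≤ m) :
    Integrable (fun p : (Fin d → ℝ) × (Fin d → Fin m → ℝ) => p.1 ⬝ᵥ ((grm p.2)⁻¹) *ᵥ p.1) ((gam d).prod (gamd d m)) ∧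
    ∫ p : (Fin d → ℝ) × (Fin d → Fin m → ℝ), p.1 ⬝ᵥ ((grm p.2)⁻¹) *ᵥ p.1 ∂((gam d).prod (gamd d m))
      = d / ((m : ℝ) - d - 1) := by
  obtain ⟨t1, t2⟩ := E_trace hd hr
  have hmeas : Measurable (fun p : (Fin d → ℝ) × (Fin d → Fin m → ℝ) => p.1 ⬝ᵥ ((grm p.2)⁻¹) *ᵥ p.1) := by
    simp only [dotProduct, mulVec]
    refine Finset.measurable_sum _ fun a _ => Measurable.mul (by fun_prop) (Finset.measurable_sum _ fun b _ => Measurable.mul ?_ (by fun_prop))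
    exact (measurable_inv_grm a b).comp measurable_snd
  have hnn : ∀ p : (Fin d → ℝ) × (Fin d → Fin m → ℝ), 0 ≤ p.1 ⬝ᵥ ((grm p.2)⁻¹) *ᵥ p.1 := by
    intro p
    simpa using (grm_posSemidef p.2).inv.dotProduct_mulVec_nonneg p.1
  have hIntg : Integrable (fun p : (Fin d → ℝ) × (Fin d → Fin m → ℝ) => p.1 ⬝ᵥ ((grm p.2)⁻¹) *ᵥ p.1) ((gam d).prod (gamd d m)) := by
    rw [integrable_prod_iff' hmeas.aestronglyMeasurable]
    refine ⟨Filter.Eventually.of_forall fun Z => (E_quad_fix ((grm Z)⁻¹)).1, ?_⟩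
    refine t1.congr (Filter.Eventually.of_forall fun Z => ?_)
    have h1 : ∫ z : Fin d → ℝ, ‖z ⬝ᵥ ((grm Z)⁻¹) *ᵥ z‖ ∂(gam d) = ∫ z : Fin d → ℝ, z ⬝ᵥ ((grm Z)⁻¹) *ᵥ z ∂(gam d) :=
      integral_congr_ae (Filter.Eventually.of_forall fun z => Real.norm_of_nonneg (hnn (z, Z)))
    exact (h1.trans (E_quad_fix ((grm Z)⁻¹)).2).symm
  refine ⟨hIntg, ?_⟩
  rw [integral_prod_symm _ hIntg, ← t2]
  exact integral_congr_ae (Filter.Eventually.of_forall fun Z => (E_quad_fix ((grm Z)⁻¹)).2)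

lemma curry_mp (n d : ℕ) : MeasurePreserving (fun (f : Fin n × Fin d → ℝ) (i : Fin n) (j : Fin d) => f (i, j))
    (Measure.pi fun _ => gaussianReal 0 1) (gamd n d) := by
  refine ⟨by fun_prop, ?_⟩
  have := Measure.infinitePi_map_curry (fun (_ : Fin n) (_ : Fin d) => gaussianReal 0 1)
  simp only [Measure.infinitePi_eq_pi] at this
  exact this

lemma reindex_mp (n d : ℕ) : MeasurePreserving (fun (f : Fin n × Fin d → ℝ) (p : Fin d × Fin n) => f (p.2, p.1))
    (Measure.pi fun _ => gaussianReal 0 1) (Measure.pi fun _ => gaussianReal 0 1) := by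
  have := measurePreserving_piCongrLeft (fun _ : Fin d × Fin n => gaussianReal 0 1) (Equiv.prodComm (Fin n) (Fin d))
  convert this using 1
  funext f p
  have := MeasurableEquiv.piCongrLeft_apply_apply (β := fun _ : Fin d × Fin n => ℝ) (Equiv.prodComm (Fin n) (Fin d)) f (p.2, p.1)
  exact this.symm

lemma swap_mp (n d : ℕ) : MeasurePreserving (fun (Y : Fin n → Fin d → ℝ) (k : Fin d) (i : Fin n) => Y i k)
    (gamd n d) (gamd d n) := by
  refine ⟨by fun_prop, ?_⟩
  rw [← (curry_mp n d).map_eq, Measure.map_map (by fun_prop) (by fun_prop)]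
  exact ((curry_mp d n).comp (reindex_mp n d)).map_eq

lemma exists_U (m : ℕ) : ∃ U : Matrix (Fin (m + 1)) (Fin (m + 1)) ℝ, U * Uᵀ = 1 ∧
    ∀ i, U 0 i = (√((m + 1 : ℕ) : ℝ))⁻¹ := by
  have hin : ∀ x y : EuclideanSpace ℝ (Fin (m + 1)), inner ℝ x y = x.ofLp ⬝ᵥ y.ofLp := by
    intro x y; simp [EuclideanSpace.inner_eq_star_dotProduct, dotProduct_comm]
  have hpos : (0 : ℝ) < ((m + 1 : ℕ) : ℝ) := by positivity
  let v : Fin (m + 1) → EuclideanSpace ℝ (Fin (m + 1)) := fun _ => WithLp.toLp 2 fun _ => (√((m + 1 : ℕ) : ℝ))⁻¹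
  have hv : Orthonormal ℝ (({0} : Set (Fin (m + 1))).domRestrict v) := by
    rw [orthonormal_iff_ite]
    rintro ⟨i, hi⟩ ⟨j, hj⟩
    rw [Set.mem_singleton_iff] at hi hj
    subst hi; subst hj
    rw [hin, if_pos rfl]
    change ∑ _i : Fin (m + 1), (√((m + 1 : ℕ) : ℝ))⁻¹ * (√((m + 1 : ℕ) : ℝ))⁻¹ = 1
    rw [Finset.sum_const, Finset.card_univ, Fintype.card_fin, nsmul_eq_mul, ← mul_inv, Real.mul_self_sqrt hpos.le,
      mul_inv_cancel₀ hpos.ne']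
  obtain ⟨b, hb⟩ := hv.exists_orthonormalBasis_extension_of_card_eq (by simp)
  refine ⟨of fun i => (b i).ofLp, ?_, fun i => ?_⟩
  · ext i j
    have h1 := orthonormal_iff_ite.mp b.orthonormal i j
    rw [hin] at h1
    rw [one_apply, ← h1]
    simp [mul_apply, dotProduct]
  · rw [of_apply, hb 0 rfl]

/-- The map sending the sample to its rotated version. -/
def rot {m d : ℕ} (U : Matrix (Fin (m + 1)) (Fin (m + 1)) ℝ) (Y : Fin (m + 1) → Fin d → ℝ) :
    (Fin d → ℝ) × (Fin d → Fin m → ℝ) :=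
  (fun k => (U *ᵥ fun i => Y i k) 0, fun k a => (U *ᵥ fun i => Y i k) a.succ)

lemma rot_mp {m d : ℕ} (U : Matrix (Fin (m + 1)) (Fin (m + 1)) ℝ) (hU : U * Uᵀ = 1) :
    MeasurePreserving (rot (d := d) U) (stdGaussianSample (m + 1) d) ((gam d).prod (gamd d m)) := by
  have s1 := swap_mp (m + 1) d
  have s2 : MeasurePreserving (fun (X : Fin d → Fin (m + 1) → ℝ) k => U *ᵥ X k) (gamd d (m + 1)) (gamd d (m + 1)) :=
    measurePreserving_pi (fun _ => gam (m + 1)) (fun _ => gam (m + 1)) fun _ => gam_map U hU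
  have s3 : MeasurePreserving (fun (X : Fin d → Fin (m + 1) → ℝ) k =>
      MeasurableEquiv.piFinSuccAbove (fun _ : Fin (m + 1) => ℝ) 0 (X k)) (gamd d (m + 1))
      (Measure.pi fun _ : Fin d => (gaussianReal 0 1).prod (gam m)) :=
    measurePreserving_pi (fun _ => gam (m + 1)) (fun _ => (gaussianReal 0 1).prod (gam m)) fun _ =>
      measurePreserving_piFinSuccAbove (fun _ : Fin (m + 1) => gaussianReal 0 1) 0
  have s4 := measurePreserving_arrowProdEquivProdArrow ℝ (Fin m → ℝ) (Fin d) (fun _ => gaussianReal 0 1) (fun _ => gam m)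
  exact s4.comp (s3.comp (s2.comp s1))

lemma rot_mean {m d : ℕ} (U : Matrix (Fin (m + 1)) (Fin (m + 1)) ℝ)
    (h0 : ∀ i, U 0 i = (√((m + 1 : ℕ) : ℝ))⁻¹) (Y : Fin (m + 1) → Fin d → ℝ) :
    sampleMean (m + 1) d Y = (√((m + 1 : ℕ) : ℝ))⁻¹ • (rot U Y).1 := by
  have hpos : (0 : ℝ) < ((m + 1 : ℕ) : ℝ) := by positivity
  funext k
  simp only [sampleMean, rot, Pi.smul_apply, smul_eq_mul, mulVec, dotProduct, h0, Finset.sum_apply]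
  rw [← Finset.mul_sum, ← mul_assoc, ← mul_inv, Real.mul_self_sqrt hpos.le]

lemma rot_cov {m d : ℕ} (U : Matrix (Fin (m + 1)) (Fin (m + 1)) ℝ) (hU : U * Uᵀ = 1)
    (h0 : ∀ i, U 0 i = (√((m + 1 : ℕ) : ℝ))⁻¹) (Y : Fin (m + 1) → Fin d → ℝ) :
    empCov (m + 1) d Y = (((m + 1 : ℕ) : ℝ))⁻¹ • grm (rot U Y).2 := by
  have hpos : (0 : ℝ) < ((m + 1 : ℕ) : ℝ) := by positivity
  have hU' : Uᵀ * U = 1 := mul_eq_one_comm.mp hU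
  unfold empCov
  congr 1
  ext k l
  have e1 : ∀ x y : Fin (m + 1) → ℝ, (U *ᵥ x) ⬝ᵥ (U *ᵥ y) = x ⬝ᵥ y := by
    intro x y
    rw [dotProduct_mulVec, ← mulVec_transpose, mulVec_mulVec, hU', one_mulVec]
  have e2 := e1 (fun i => Y i k) (fun i => Y i l)
  rw [dotProduct, Fin.sum_univ_succ] at e2
  have hs : ∀ k, ∑ i, Y i k = ((m + 1 : ℕ) : ℝ) * sampleMean (m + 1) d Y k := by
    intro k
    simp only [sampleMean, Pi.smul_apply, smul_eq_mul, Finset.sum_apply]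
    rw [mul_inv_cancel_left₀ hpos.ne']
  have hz : ∀ k, (U *ᵥ fun i => Y i k) 0 = √((m + 1 : ℕ) : ℝ) * sampleMean (m + 1) d Y k := by
    intro k
    rw [rot_mean U h0 Y, Pi.smul_apply, smul_eq_mul, mul_inv_cancel_left₀ (Real.sqrt_pos.mpr hpos).ne']
    rfl
  rw [hz, hz, mul_mul_mul_comm, Real.mul_self_sqrt hpos.le] at e2
  simp only [Matrix.sum_apply, vecMulVec_apply, Pi.sub_apply, grm, of_apply, rot]
  have e3 : (fun a : Fin m => (U *ᵥ fun i => Y i k) a.succ) ⬝ᵥ (fun a : Fin m => (U *ᵥ fun i => Y i l) a.succ)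
      = (∑ i, Y i k * Y i l) - ((m + 1 : ℕ) : ℝ) * (sampleMean (m + 1) d Y k * sampleMean (m + 1) d Y l) := by
    rw [eq_sub_iff_add_eq']; exact e2
  rw [e3]
  generalize sampleMean (m + 1) d Y = s at *
  have : ∀ i, (Y i k - s k) * (Y i l - s l) = Y i k * Y i l - s k * Y i l - s l * Y i k + s k * s l := by
    intro i; ring
  simp only [this, Finset.sum_add_distrib, Finset.sum_sub_distrib, ← Finset.mul_sum, hs]
  simp
  ring

/-- The integrand in rotated coordinates. -/
noncomputable def integrandF (d m : ℕ) (p : (Fin d → ℝ) × (Fin d → Fin m → ℝ)) : ℝ :=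
  (1 / 2) * (Real.log (grm p.2).det - d * Real.log ((m + 1 : ℕ) : ℝ) + ((m + 1 : ℕ) : ℝ) * ((grm p.2)⁻¹).trace
    + p.1 ⬝ᵥ ((grm p.2)⁻¹) *ᵥ p.1 - d)

lemma E_F {d m : ℕ} (hd : 1 ≤ d) (hr : d + 2 ≤ m) :
    Integrable (integrandF d m) ((gam d).prod (gamd d m)) ∧
    ∫ p, integrandF d m p ∂((gam d).prod (gamd d m)) =
    (1 / 2) * ((∑ j ∈ Finset.range d, (digamma (((m : ℝ) - j) / 2) + Real.log 2)) - d * Real.log ((m + 1 : ℕ) : ℝ)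
      + ((m + 1 : ℕ) : ℝ) * (d / ((m : ℝ) - d - 1)) + d / ((m : ℝ) - d - 1) - d) := by
  obtain ⟨l1, l2⟩ := E_log m d (by omega)
  obtain ⟨t1, t2⟩ := E_trace hd hr
  obtain ⟨q1, q2⟩ := E_quad hd hr
  have l3 := l1.comp_snd (gam d)
  have t3 := t1.comp_snd (gam d)
  have l4 := integral_fun_snd (μ := gam d) (ν := gamd d m) (fun Z => Real.log (grm Z).det)
  have t4 := integral_fun_snd (μ := gam d) (ν := gamd d m) (fun Z => ((grm Z)⁻¹).trace)
  simp only [probReal_univ, one_smul] at l4 t4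
  have i1 := l3.sub (integrable_const ((d : ℝ) * Real.log ((m + 1 : ℕ) : ℝ)))
  have i2 := i1.add (t3.const_mul ((m + 1 : ℕ) : ℝ))
  have i3 := i2.add q1
  have i4 := i3.sub (integrable_const (d : ℝ))
  refine ⟨i4.const_mul (1 / 2), ?_⟩
  unfold integrandF
  rw [integral_const_mul]
  congr 1
  refine (integral_sub i3 (integrable_const (d : ℝ))).trans ?_
  refine (congrArg (· - _) ((integral_add i2 q1).trans (congrArg (· + _) ((integral_add i1 (t3.const_mul _)).trans
    (congrArg (· + _) (integral_sub l3 (integrable_const _))))))).trans ?_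
  rw [integral_const_mul ((m + 1 : ℕ) : ℝ), l4, t4, l2, t2, q2]
  simp

theorem forward_KL_unknown_mean_closed_form (d n : ℕ) (hd : 1 ≤ d) (hn : d + 2 < n) :
    ∫ Y, (1 / 2) * (Real.log (empCov n d Y).det + ((empCov n d Y)⁻¹).trace
        + (sampleMean n d Y) ⬝ᵥ ((empCov n d Y)⁻¹).mulVec (sampleMean n d Y)
        - d) ∂(stdGaussianSample n d)
      = (1 / 2) * (gFun d n - d) := by
  obtain ⟨m, rfl⟩ : ∃ m, n = m + 1 := ⟨n - 1, by omega⟩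
  have hr : d + 2 ≤ m := by omega
  have hpos : (0 : ℝ) < ((m + 1 : ℕ) : ℝ) := by positivity
  obtain ⟨U, hU, h0⟩ := exists_U m
  have mp := rot_mp (d := d) U hU
  obtain ⟨f1, f2⟩ := E_F hd hr
  have hns : ∀ᵐ p ∂((gam d).prod (gamd d m)), (grm p.2).det ≠ 0 :=
    Measure.quasiMeasurePreserving_snd.ae (nonsing m d (by omega))
  have hns2 := mp.quasiMeasurePreserving.ae hns
  have heq : (fun Y => (1 / 2) * (Real.log (empCov (m + 1) d Y).det + ((empCov (m + 1) d Y)⁻¹).trace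
        + (sampleMean (m + 1) d Y) ⬝ᵥ ((empCov (m + 1) d Y)⁻¹).mulVec (sampleMean (m + 1) d Y)
        - d)) =ᵐ[stdGaussianSample (m + 1) d] fun Y => integrandF d m (rot U Y) := by
    filter_upwards [hns2] with Y hY
    have hinv : (empCov (m + 1) d Y)⁻¹ = ((m + 1 : ℕ) : ℝ) • (grm (rot U Y).2)⁻¹ := by
      rw [rot_cov U hU h0 Y]
      refine inv_eq_left_inv ?_
      rw [smul_mul_smul_comm, nonsing_inv_mul _ (isUnit_iff_ne_zero.mpr hY), mul_inv_cancel₀ hpos.ne', one_smul]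
    have hdet : Real.log (empCov (m + 1) d Y).det = Real.log (grm (rot U Y).2).det - d * Real.log ((m + 1 : ℕ) : ℝ) := by
      rw [rot_cov U hU h0 Y, det_smul, Fintype.card_fin, Real.log_mul (by positivity) hY, Real.log_pow, Real.log_inv]
      ring
    rw [hdet, hinv, rot_mean U h0 Y, trace_smul]
    unfold integrandF
    congr 3
    rw [smul_mulVec, mulVec_smul, smul_dotProduct, dotProduct_smul, dotProduct_smul]
    simp only [smul_eq_mul]
    have hs : √((m + 1 : ℕ) : ℝ) ≠ 0 := (Real.sqrt_pos.mpr hpos).ne'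
    have hs2 : √((m + 1 : ℕ) : ℝ) * √((m + 1 : ℕ) : ℝ) = ((m + 1 : ℕ) : ℝ) := Real.mul_self_sqrt hpos.le
    generalize (rot U Y).1 ⬝ᵥ ((grm (rot U Y).2)⁻¹ *ᵥ (rot U Y).1) = q
    generalize √((m + 1 : ℕ) : ℝ) = t at hs hs2
    rw [← hs2]
    field_simp
  rw [integral_congr_ae heq]
  have := integral_map (f := integrandF d m) mp.measurable.aemeasurable (by rw [mp.map_eq]; exact f1.aestronglyMeasurable)
  rw [← this, mp.map_eq, f2]
  congr 2
  unfold gFun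
  have hre : ∑ j ∈ Finset.Icc 1 d, digamma ((((m + 1 : ℕ) : ℝ) - j) / 2)
      = ∑ j ∈ Finset.range d, digamma (((m : ℝ) - j) / 2) := by
    refine (Finset.sum_bij (fun j _ => j + 1) (fun j hj => ?_) (fun a _ b _ h => ?_) (fun b hb => ?_)
      (fun j hj => ?_)).symm
    · simp at hj ⊢; omega
    · omega
    · simp at hb
      exact ⟨b - 1, by simp; omega, by omega⟩
    · push_cast; congr 2; ring
  rw [hre, Finset.sum_add_distrib, Finset.sum_const, Finset.card_range, nsmul_eq_mul,
    Real.log_div hpos.ne' two_ne_zero]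
  have hden : (((m + 1 : ℕ) : ℝ) - d - 2) = (m : ℝ) - d - 1 := by push_cast; ring
  rw [hden]
  ring
end

section
/- For every integer d ≥ 1, the function g_d(x) := (∑_{j=1}^d ψ((x−j)/2)) − d·log(x/2) + (x+1)·d/(x−d−2) is strictly decreasing on the interval (d+2, ∞); that is, for all x, y with d+2 < x < y one has g_d(y) < g_d(x). -/
lemma hasDerivAt_logGamma {t : ℝ} (ht : 0 < t) :
    HasDerivAt (fun t => Real.log (Real.Gamma t)) (digamma t) t := by
  have h1 : DifferentiableAt ℝ Real.Gamma t := by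
    apply Real.differentiableAt_Gamma
    intro m h
    have : (0 : ℝ) ≤ m := Nat.cast_nonneg m
    linarith
  exact (h1.log (Real.Gamma_pos_of_pos ht).ne').hasDerivAt

lemma logGamma_add_one {t : ℝ} (ht : 0 < t) :
    Real.log (Real.Gamma (t + 1)) = Real.log t + Real.log (Real.Gamma t) := by
  rw [Real.Gamma_add_one ht.ne', Real.log_mul ht.ne' (Real.Gamma_pos_of_pos ht).ne']

lemma digamma_add_one {t : ℝ} (ht : 0 < t) : digamma (t + 1) = 1 / t + digamma t := by
  have h1 : HasDerivAt (fun s => Real.log (Real.Gamma (s + 1))) (digamma (t + 1)) t :=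
    (hasDerivAt_logGamma (by linarith : 0 < t + 1)).comp_add_const t 1
  have h2 : HasDerivAt (fun s => Real.log s + Real.log (Real.Gamma s)) (t⁻¹ + digamma t) t :=
    (Real.hasDerivAt_log ht.ne').add (hasDerivAt_logGamma ht)
  have h3 : (fun s => Real.log (Real.Gamma (s + 1))) =ᶠ[nhds t]
      (fun s => Real.log s + Real.log (Real.Gamma s)) := by
    filter_upwards [lt_mem_nhds ht] with s hs
    exact logGamma_add_one hs
  have h4 := h1.unique (h2.congr_of_eventuallyEq h3)
  rw [h4, one_div]

lemma digamma_le_log {t : ℝ} (ht : 0 < t) : digamma t ≤ Real.log t := by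
  have h := Real.convexOn_log_Gamma.le_slope_of_hasDerivAt (x := t) (y := t + 1) ht
    (by simp; linarith) (by linarith) (hasDerivAt_logGamma ht)
  simp only [slope_def_field, Function.comp, logGamma_add_one ht] at h
  simpa using h

lemma log_le_digamma {t : ℝ} (ht : 0 < t) : Real.log t ≤ digamma (t + 1) := by
  have h := Real.convexOn_log_Gamma.slope_le_of_hasDerivAt (x := t) (y := t + 1) ht
    (by simp; linarith) (by linarith) (hasDerivAt_logGamma (by linarith : 0 < t + 1))
  simp only [slope_def_field, Function.comp, logGamma_add_one ht] at h
  simpa using h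

lemma r_anti {a b : ℝ} (ha : 1 < a) (hab : a < b) :
    Real.log b - Real.log (b - 1) - 1 / b ≤ Real.log a - Real.log (a - 1) - 1 / a := by
  have h0 : 0 < a - 1 := by linarith
  have h1 : 0 < b - 1 := by linarith
  have ha0 : 0 < a := by linarith
  have hb0 : 0 < b := by linarith
  have h := Real.log_le_sub_one_of_pos (x := b * (a - 1) / ((b - 1) * a)) (by positivity)
  rw [Real.log_div (by positivity) (by positivity), Real.log_mul hb0.ne' h0.ne',
    Real.log_mul h1.ne' ha0.ne'] at h
  have h2 : b * (a - 1) / ((b - 1) * a) - 1 ≤ 1 / b - 1 / a := by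
    have : 1 / b - 1 / a - (b * (a - 1) / ((b - 1) * a) - 1) = (b - a) / (a * b * (b - 1)) := by
      field_simp
      ring
    have : 0 ≤ (b - a) / (a * b * (b - 1)) := div_nonneg (by linarith) (by positivity)
    linarith
  linarith

lemma shift_le (n : ℕ) : ∀ {a b : ℝ}, 1 < a → a < b →
    digamma b - Real.log (b - 1) - (digamma a - Real.log (a - 1)) ≤
    digamma (b + n) - Real.log (b + n - 1) - (digamma (a + n) - Real.log (a + n - 1)) := by
  induction n with
  | zero => intro a b _ _; simp
  | succ n ih =>
    intro a b ha hab
    have h := ih (a := a + 1) (b := b + 1) (by linarith) (by linarith)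
    have h1 := r_anti ha hab
    have h2 := digamma_add_one (by linarith : 0 < a)
    have h3 := digamma_add_one (by linarith : 0 < b)
    have e1 : a + 1 + (n : ℝ) = a + ((n + 1 : ℕ) : ℝ) := by push_cast; ring
    have e2 : b + 1 + (n : ℝ) = b + ((n + 1 : ℕ) : ℝ) := by push_cast; ring
    rw [e1, e2] at h
    simp only [add_sub_cancel_right] at h
    linarith

lemma digamma_sub_le {a b : ℝ} (ha : 1 < a) (hab : a < b) :
    digamma b - digamma a ≤ Real.log (b - 1) - Real.log (a - 1) := by
  refine le_of_forall_pos_le_add fun ε hε => ?_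
  obtain ⟨n, hn⟩ := exists_nat_gt (1 / ε)
  have hn0 : (0 : ℝ) ≤ n := Nat.cast_nonneg n
  have h := shift_le n ha hab
  have h1 := digamma_le_log (by linarith : 0 < b + n)
  have h2 := log_le_digamma (by linarith : 0 < a + n - 1)
  rw [sub_add_cancel] at h2
  have hp : 0 < b + n - 1 := by linarith
  have h3 := Real.log_le_sub_one_of_pos (x := (b + n) / (b + n - 1)) (by
    apply div_pos <;> linarith)
  rw [Real.log_div (by linarith) hp.ne'] at h3
  have h4 : (b + n) / (b + n - 1) - 1 = 1 / (b + n - 1) := by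
    field_simp
    ring
  have h5 : 1 / (b + n - 1) ≤ ε := by
    rw [div_le_iff₀ hp]
    rw [div_lt_iff₀ hε] at hn
    nlinarith
  linarith

lemma term_lt {m c x y : ℝ} (hc : 0 ≤ c) (hcm : c ≤ m) (hx : m < x) (hxy : x < y) :
    Real.log (y - c) - Real.log (x - c) - (Real.log y - Real.log x)
      < (m + 1) / (x - m) - (m + 1) / (y - m) := by
  have hx0 : 0 < x := by linarith
  have hy0 : 0 < y := by linarith
  have hxc : 0 < x - c := by linarith
  have hyc : 0 < y - c := by linarith
  have hxm : 0 < x - m := by linarith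
  have hym : 0 < y - m := by linarith
  have hd : 0 < y - x := by linarith
  have h := Real.log_le_sub_one_of_pos (x := (y - c) * x / ((x - c) * y)) (by positivity)
  rw [Real.log_div (by positivity) (by positivity), Real.log_mul hyc.ne' hx0.ne',
    Real.log_mul hxc.ne' hy0.ne'] at h
  have e1 : (y - c) * x / ((x - c) * y) - 1 = (y - x) * c / ((x - c) * y) := by
    field_simp
    ring
  have e2 : (m + 1) / (x - m) - (m + 1) / (y - m) = (y - x) * (m + 1) / ((x - m) * (y - m)) := by
    field_simp
    ring
  have h2 : (y - x) * c / ((x - c) * y) < (y - x) * (m + 1) / ((x - m) * (y - m)) := by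
    apply div_lt_div₀
    · apply mul_lt_mul_of_pos_left _ hd
      linarith
    · apply mul_le_mul <;> linarith
    · apply mul_nonneg <;> linarith
    · positivity
  linarith

theorem gFun_strictAnti (d : ℕ) (hd : 1 ≤ d) :
    ∀ x y : ℝ, (d : ℝ) + 2 < x → x < y → gFun d y < gFun d x := by
  intro x y hx hxy
  have key : ∀ z : ℝ, (d : ℝ) + 2 < z → gFun d z = ∑ j ∈ Finset.Icc 1 d,
      (digamma ((z - j) / 2) - Real.log (z / 2) + (1 + (d + 3) / (z - d - 2))) := by
    intro z hz
    have hz' : z - d - 2 ≠ 0 := by linarith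
    rw [Finset.sum_add_distrib, Finset.sum_sub_distrib, Finset.sum_const, Finset.sum_const,
      Nat.card_Icc, gFun]
    simp only [add_tsub_cancel_right, nsmul_eq_mul]
    congr 1
    field_simp
    ring
  rw [key x hx, key y (by linarith)]
  apply Finset.sum_lt_sum_of_nonempty
  · exact ⟨1, by simp [hd]⟩
  intro j hj
  have hj2 : (j : ℝ) ≤ d := by exact_mod_cast (Finset.mem_Icc.mp hj).2
  have hj0 : (0 : ℝ) ≤ j := Nat.cast_nonneg j
  have h1 := digamma_sub_le (a := (x - j) / 2) (b := (y - j) / 2) (by linarith) (by linarith)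
  have h2 := term_lt (m := d + 2) (c := j + 2) (by linarith) (by linarith) hx hxy
  have e : ∀ z : ℝ, (z - j) / 2 - 1 = (z - (j + 2)) / 2 := fun z => by ring
  rw [e, e, Real.log_div (by linarith) two_ne_zero, Real.log_div (by linarith) two_ne_zero] at h1
  rw [Real.log_div (by linarith) two_ne_zero, Real.log_div (by linarith) two_ne_zero]
  have e3 : ∀ z : ℝ, ((d : ℝ) + 2 + 1) / (z - (d + 2)) = (d + 3) / (z - d - 2) := fun z => by
    congr 1 <;> ring
  rw [e3, e3] at h2
  linarith
end
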